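/- arXiv:1303.3567 — 9 statements merged into one kernel-verified Lean document; each statement's English description precedes it below -/
import Mathlib

section
/- Let (X, Y, η, μ, ψ, ε, δ, φ) be a left Frobenius pair in a monoidal category C. Then φ is a homomorphism of right X-modules; that is, the square commutes: φ ∘ μ = (Y ⊗ μ) ∘ α⁻¹ ∘ (φ ⊗ X) as morphisms X ⊗ X → Y ⊗ X (where α is the associator (Y ⊗ X) ⊗ X ≅ Y ⊗ (X ⊗ X)). -/
open CategoryTheory MonoidalCategory

universe v u

/-- A left Frobenius pair in a monoidal category `C`, following Rezk:
objects `X`, `Y`; a monoid structure `(X, η, μ)`; a comonoid structure `(Y, ε, δ)`;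
a left `X`-module structure `ψ` on `Y`; a left `Y`-comodule structure `φ` on `X`;
such that `φ` is a map of left `X`-modules and `ψ` is a map of left `Y`-comodules. -/
structure LeftFrobeniusPair (C : Type u) [Category.{v} C] [MonoidalCategory C] where
  X : C
  Y : C
  η : 𝟙_ C ⟶ X
  μ : X ⊗ X ⟶ X
  ψ : X ⊗ Y ⟶ Y
  ε : Y ⟶ 𝟙_ C
  δ : Y ⟶ Y ⊗ Y
  φ : X ⟶ Y ⊗ X
  /-- (1a) associativity of `μ` -/
  mul_assoc' : (μ ▷ X) ≫ μ = (α_ X X X).hom ≫ (X ◁ μ) ≫ μ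
  /-- (1a) left unit -/
  one_mul' : (η ▷ X) ≫ μ = (λ_ X).hom
  /-- (1a) right unit -/
  mul_one' : (X ◁ η) ≫ μ = (ρ_ X).hom
  /-- (1b) coassociativity of `δ` -/
  comul_assoc' : δ ≫ (δ ▷ Y) ≫ (α_ Y Y Y).hom = δ ≫ (Y ◁ δ)
  /-- (1b) left counit -/
  counit_comul' : δ ≫ (ε ▷ Y) = (λ_ Y).inv
  /-- (1b) right counit -/
  comul_counit' : δ ≫ (Y ◁ ε) = (ρ_ Y).inv
  /-- (2a) `ψ` is an action -/
  mul_act' : (μ ▷ Y) ≫ ψ = (α_ X X Y).hom ≫ (X ◁ ψ) ≫ ψ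
  /-- (2a) unit acts trivially -/
  one_act' : (η ▷ Y) ≫ ψ = (λ_ Y).hom
  /-- (2b) `φ` is a coaction -/
  coact_comul' : φ ≫ (δ ▷ X) ≫ (α_ Y Y X).hom = φ ≫ (Y ◁ φ)
  /-- (2b) counit of the coaction -/
  coact_counit' : φ ≫ (ε ▷ X) = (λ_ X).inv
  /-- (3a) `φ` is a homomorphism of left `X`-modules -/
  phi_module' : μ ≫ φ = (X ◁ φ) ≫ (α_ X Y X).inv ≫ (ψ ▷ X)
  /-- (3b) `ψ` is a homomorphism of left `Y`-comodules -/
  psi_comodule' : ψ ≫ δ = (φ ▷ Y) ≫ (α_ Y X Y).hom ≫ (Y ◁ ψ)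

namespace LeftFrobeniusPair

variable {C : Type u} [Category.{v} C] [MonoidalCategory C] (P : LeftFrobeniusPair C)

/-- The multiplication is determined by the coaction and the pairing `ψ ≫ ε`. -/
lemma mul_eq_pairing :
    P.μ = P.X ◁ P.φ ≫ (α_ P.X P.Y P.X).inv ≫ (P.ψ ≫ P.ε) ▷ P.X ≫ (λ_ P.X).hom := by
  have h : P.μ = P.μ ≫ P.φ ≫ P.ε ▷ P.X ≫ (λ_ P.X).hom := by
    rw [reassoc_of% P.coact_counit', Iso.inv_hom_id, Category.comp_id]
  rw [h, reassoc_of% P.phi_module', comp_whiskerRight_assoc]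

/-- The action is determined by the coaction and the pairing `ψ ≫ ε`. -/
lemma act_eq_pairing :
    P.ψ = P.φ ▷ P.Y ≫ (α_ P.Y P.X P.Y).hom ≫ P.Y ◁ (P.ψ ≫ P.ε) ≫ (ρ_ P.Y).hom := by
  have h : P.ψ = P.ψ ≫ P.δ ≫ P.Y ◁ P.ε ≫ (ρ_ P.Y).hom := by
    rw [reassoc_of% P.comul_counit', Iso.inv_hom_id, Category.comp_id]
  conv_lhs => rw [h, reassoc_of% P.psi_comodule', ← whiskerLeft_comp_assoc]

end LeftFrobeniusPair

/-- `φ` is a homomorphism of right `X`-modules. -/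
theorem stmt0 {C : Type u} [Category.{v} C] [MonoidalCategory C]
    (P : LeftFrobeniusPair C) :
    P.μ ≫ P.φ = (P.φ ▷ P.X) ≫ (α_ P.Y P.X P.X).hom ≫ (P.Y ◁ P.μ) := by
  rw [P.phi_module', P.mul_eq_pairing]
  conv_lhs => rw [P.act_eq_pairing]
  generalize P.ψ ≫ P.ε = p
  calc
    _ = (P.X ◁ P.φ ≫ P.φ ▷ (P.Y ⊗ P.X)) ≫ (α_ P.Y P.X (P.Y ⊗ P.X)).hom ≫
        P.Y ◁ ((α_ P.X P.Y P.X).inv ≫ p ▷ P.X ≫ (λ_ P.X).hom) := by monoidal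
    _ = _ := by
      rw [whisker_exchange]
      monoidal
end

section
/- Let (X, Y, η, μ, ψ, ε, δ, φ) be a left Frobenius pair in a monoidal category C. Then ψ is a homomorphism of right Y-comodules; that is, δ ∘ ψ = (ψ ⊗ Y) ∘ α⁻¹ ∘ (X ⊗ δ) as morphisms X ⊗ Y → Y ⊗ Y (where α is the associator (X ⊗ Y) ⊗ Y ≅ X ⊗ (Y ⊗ Y)). -/
open CategoryTheory MonoidalCategory

universe v u

namespace LeftFrobeniusPair

variable {C : Type u} [Category.{v} C] [MonoidalCategory C] (P : LeftFrobeniusPair C)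

/-- The coaction is determined by its value on the unit. -/
theorem phi_eq : P.φ = (ρ_ P.X).inv ≫ (P.X ◁ (P.η ≫ P.φ)) ≫ (α_ P.X P.Y P.X).inv ≫
    (P.ψ ▷ P.X) := by
  rw [Iso.eq_inv_comp, ← P.mul_one', Category.assoc, P.phi_module']
  simp

/-- The comultiplication is determined by the coaction on the unit. -/
theorem delta_eq : P.δ = (λ_ P.Y).inv ≫ ((P.η ≫ P.φ) ▷ P.Y) ≫ (α_ P.Y P.X P.Y).hom ≫
    (P.Y ◁ P.ψ) := by
  rw [Iso.eq_inv_comp, ← P.one_act', Category.assoc, P.psi_comodule']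
  simp

end LeftFrobeniusPair

/-- `ψ` is a homomorphism of right `Y`-comodules. -/
theorem stmt1 {C : Type u} [Category.{v} C] [MonoidalCategory C]
    (P : LeftFrobeniusPair C) :
    P.ψ ≫ P.δ = (P.X ◁ P.δ) ≫ (α_ P.X P.Y P.Y).inv ≫ (P.ψ ▷ P.Y) := by
  rw [P.psi_comodule', P.phi_eq, P.delta_eq]
  generalize P.η ≫ _ = c
  have exch := whisker_exchange P.ψ P.ψ
  calc
    _ = 𝟙 _ ⊗≫ (P.X ◁ c ▷ P.Y) ⊗≫ ((P.ψ ▷ (P.X ⊗ P.Y)) ≫ (P.Y ◁ P.ψ)) := by monoidal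
    _ = _ := by
      rw [← exch]
      monoidal
end

section
/- Let (X, Y, η, μ, ψ, ε, δ, φ) be a left Frobenius pair in a monoidal category C, and set α = φ ∘ η : 𝟙 → Y ⊗ X and β = ε ∘ ψ : X ⊗ Y → 𝟙. Then the composite X ≅ X ⊗ 𝟙 →(X ⊗ α) X ⊗ (Y ⊗ X) ≅ (X ⊗ Y) ⊗ X →(β ⊗ X) 𝟙 ⊗ X ≅ X (using the unitors and associator) is the identity morphism of X. -/
open CategoryTheory MonoidalCategory

universe v u

/-- The first zig-zag identity: with `α = φ ∘ η` and `β = ε ∘ ψ`, the composite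
`X ≅ X ⊗ 𝟙 → X ⊗ (Y ⊗ X) ≅ (X ⊗ Y) ⊗ X → 𝟙 ⊗ X ≅ X` is the identity of `X`. -/
theorem stmt2 {C : Type u} [Category.{v} C] [MonoidalCategory C]
    (P : LeftFrobeniusPair C) :
    (ρ_ P.X).inv ≫ (P.X ◁ (P.η ≫ P.φ)) ≫ (α_ P.X P.Y P.X).inv ≫
      ((P.ψ ≫ P.ε) ▷ P.X) ≫ (λ_ P.X).hom = 𝟙 P.X := by
  have h : (P.X ◁ P.φ) ≫ (α_ P.X P.Y P.X).inv ≫ (P.ψ ▷ P.X) ≫ (P.ε ▷ P.X) =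
      P.μ ≫ (λ_ P.X).inv := by
    rw [← P.coact_counit', reassoc_of% P.phi_module']
  rw [whiskerLeft_comp, comp_whiskerRight]
  simp only [Category.assoc]
  rw [reassoc_of% h, reassoc_of% P.mul_one']
  simp
end

section
/- Let (X, Y, η, μ, ψ, ε, δ, φ) be a left Frobenius pair in a monoidal category C, and set α = φ ∘ η : 𝟙 → Y ⊗ X and β = ε ∘ ψ : X ⊗ Y → 𝟙. Then the composite Y ≅ 𝟙 ⊗ Y →(α ⊗ Y) (Y ⊗ X) ⊗ Y ≅ Y ⊗ (X ⊗ Y) →(Y ⊗ β) Y ⊗ 𝟙 ≅ Y (using the unitors and associator) is the identity morphism of Y. -/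
open CategoryTheory MonoidalCategory

universe v u

/-- The second zig-zag identity: with `α = φ ∘ η` and `β = ε ∘ ψ`, the composite
`Y ≅ 𝟙 ⊗ Y → (Y ⊗ X) ⊗ Y ≅ Y ⊗ (X ⊗ Y) → Y ⊗ 𝟙 ≅ Y` is the identity of `Y`. -/
theorem stmt3 {C : Type u} [Category.{v} C] [MonoidalCategory C]
    (P : LeftFrobeniusPair C) :
    (λ_ P.Y).inv ≫ ((P.η ≫ P.φ) ▷ P.Y) ≫ (α_ P.Y P.X P.Y).hom ≫
      (P.Y ◁ (P.ψ ≫ P.ε)) ≫ (ρ_ P.Y).hom = 𝟙 P.Y := by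
  have h : (P.φ ▷ P.Y) ≫ (α_ P.Y P.X P.Y).hom ≫ (P.Y ◁ (P.ψ ≫ P.ε)) =
      P.ψ ≫ (ρ_ P.Y).inv := by
    rw [← P.comul_counit', reassoc_of% P.psi_comodule', MonoidalCategory.whiskerLeft_comp]
  rw [comp_whiskerRight, Category.assoc, reassoc_of% h, Iso.inv_hom_id, Category.comp_id,
    P.one_act', Iso.inv_hom_id]
end

section
/- Let (X, Y, η, μ, ψ, ε, δ, φ) be a left Frobenius pair in a monoidal category C. Then the morphisms coev = φ ∘ η : 𝟙 → Y ⊗ X and ev = ε ∘ ψ : X ⊗ Y → 𝟙 form an exact pairing between Y and X (i.e., they satisfy the two triangle (zig-zag) identities, so that X is a right dual of Y and Y is a left dual of X). -/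
open CategoryTheory MonoidalCategory

universe v u

/-- `coev = φ ∘ η : 𝟙 ⟶ Y ⊗ X` and `ev = ε ∘ ψ : X ⊗ Y ⟶ 𝟙` form an exact pairing
between `Y` and `X`. -/
theorem stmt4 {C : Type u} [Category.{v} C] [MonoidalCategory C]
    (P : LeftFrobeniusPair C) :
    ∃ p : ExactPairing P.Y P.X,
      p.coevaluation' = P.η ≫ P.φ ∧ p.evaluation' = P.ψ ≫ P.ε := by
  refine ⟨⟨P.η ≫ P.φ, P.ψ ≫ P.ε, ?_, ?_⟩, rfl, rfl⟩
  · calc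
      _ = (P.X ◁ P.η) ≫ ((P.X ◁ P.φ) ≫ (α_ P.X P.Y P.X).inv ≫ (P.ψ ▷ P.X)) ≫
          (P.ε ▷ P.X) := by
        simp only [whiskerLeft_comp, comp_whiskerRight, Category.assoc]
      _ = ((P.X ◁ P.η) ≫ P.μ) ≫ P.φ ≫ (P.ε ▷ P.X) := by
        rw [← P.phi_module']
        simp only [Category.assoc]
      _ = _ := by rw [P.mul_one', P.coact_counit']
  · calc
      _ = (P.η ▷ P.Y) ≫ ((P.φ ▷ P.Y) ≫ (α_ P.Y P.X P.Y).hom ≫ (P.Y ◁ P.ψ)) ≫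
          (P.Y ◁ P.ε) := by
        simp only [whiskerLeft_comp, comp_whiskerRight, Category.assoc]
      _ = ((P.η ▷ P.Y) ≫ P.ψ) ≫ P.δ ≫ (P.Y ◁ P.ε) := by
        rw [← P.psi_comodule']
        simp only [Category.assoc]
      _ = _ := by rw [P.one_act', P.comul_counit']
end

section
/- Let (X, Y, η, μ, ψ, ε, δ, φ) be a left Frobenius pair in a monoidal category C, with α = φ ∘ η and β = ε ∘ ψ. For all objects U, V of C, the maps λ : Hom(X ⊗ U, V) → Hom(U, Y ⊗ V) defined by λ(f) = (Y ⊗ f) ∘ assoc ∘ (α ⊗ U) ∘ (left unitor)⁻¹, and λ' : Hom(U, Y ⊗ V) → Hom(X ⊗ U, V) defined by λ'(g) = left unitor ∘ (β ⊗ V) ∘ assoc⁻¹ ∘ (X ⊗ g), are mutually inverse bijections. -/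
open CategoryTheory MonoidalCategory

universe v u

/-- The duality map `λ : Hom(X ⊗ U, V) → Hom(U, Y ⊗ V)`,
`λ(f) = (Y ⊗ f) ∘ assoc ∘ ((φ ∘ η) ⊗ U) ∘ (left unitor)⁻¹`. -/
def frobLam {C : Type u} [Category.{v} C] [MonoidalCategory C]
    (P : LeftFrobeniusPair C) (U V : C) (f : P.X ⊗ U ⟶ V) : U ⟶ P.Y ⊗ V :=
  (λ_ U).inv ≫ ((P.η ≫ P.φ) ▷ U) ≫ (α_ P.Y P.X U).hom ≫ (P.Y ◁ f)


/-- The inverse duality map `λ⁻¹ : Hom(U, Y ⊗ V) → Hom(X ⊗ U, V)`,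
`λ⁻¹(g) = left unitor ∘ ((ε ∘ ψ) ⊗ V) ∘ assoc⁻¹ ∘ (X ⊗ g)`. -/
def frobLamInv {C : Type u} [Category.{v} C] [MonoidalCategory C]
    (P : LeftFrobeniusPair C) (U V : C) (g : U ⟶ P.Y ⊗ V) : P.X ⊗ U ⟶ V :=
  (P.X ◁ g) ≫ (α_ P.X P.Y V).inv ≫ ((P.ψ ≫ P.ε) ▷ V) ≫ (λ_ V).hom


/-- The objects of a left Frobenius pair are dual to each other, with coevaluation `φ ∘ η` and
evaluation `ε ∘ ψ`. -/
@[reducible]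
def LeftFrobeniusPair.exactPairing {C : Type u} [Category.{v} C] [MonoidalCategory C]
    (P : LeftFrobeniusPair C) : ExactPairing P.Y P.X where
  coevaluation' := P.η ≫ P.φ
  evaluation' := P.ψ ≫ P.ε
  coevaluation_evaluation' :=
    calc
      _ = P.X ◁ P.η ≫ (P.X ◁ P.φ ≫ (α_ P.X P.Y P.X).inv ≫ P.ψ ▷ P.X) ≫ P.ε ▷ P.X := by
        simp only [whiskerLeft_comp, comp_whiskerRight, Category.assoc]
      _ = (P.X ◁ P.η ≫ P.μ) ≫ P.φ ≫ P.ε ▷ P.X := by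
        rw [← P.phi_module']
        simp only [Category.assoc]
      _ = (ρ_ P.X).hom ≫ (λ_ P.X).inv := by
        rw [P.mul_one', P.coact_counit']
  evaluation_coevaluation' :=
    calc
      _ = P.η ▷ P.Y ≫ (P.φ ▷ P.Y ≫ (α_ P.Y P.X P.Y).hom ≫ P.Y ◁ P.ψ) ≫ P.Y ◁ P.ε := by
        simp only [whiskerLeft_comp, comp_whiskerRight, Category.assoc]
      _ = (P.η ▷ P.Y ≫ P.ψ) ≫ P.δ ≫ P.Y ◁ P.ε := by
        rw [← P.psi_comodule']
        simp only [Category.assoc]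
      _ = (λ_ P.Y).hom ≫ (ρ_ P.Y).inv := by
        rw [P.one_act', P.comul_counit']

/-- `λ` and `λ'` are mutually inverse bijections. -/
theorem stmt5 {C : Type u} [Category.{v} C] [MonoidalCategory C]
    (P : LeftFrobeniusPair C) (U V : C) :
    (∀ f : P.X ⊗ U ⟶ V, frobLamInv P U V (frobLam P U V f) = f) ∧
    (∀ g : U ⟶ P.Y ⊗ V, frobLam P U V (frobLamInv P U V g) = g) := by
  let _ := P.exactPairing
  exact ⟨(tensorLeftHomEquiv U P.Y P.X V).left_inv, (tensorLeftHomEquiv U P.Y P.X V).right_inv⟩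
end

section
/- Let (X, Y, η, μ, ψ, ε, δ, φ) be a left Frobenius pair in a monoidal category C, with α = φ ∘ η and β = ε ∘ ψ. For all objects U, V of C, the maps ρ : Hom(U ⊗ Y, V) → Hom(U, V ⊗ X) defined by ρ(f) = (f ⊗ X) ∘ assoc⁻¹ ∘ (U ⊗ α) ∘ (right unitor)⁻¹, and ρ' : Hom(U, V ⊗ X) → Hom(U ⊗ Y, V) defined by ρ'(g) = right unitor ∘ (V ⊗ β) ∘ assoc ∘ (g ⊗ Y), are mutually inverse bijections. -/
open CategoryTheory MonoidalCategory

universe v u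

/-- The duality map `ρ : Hom(U ⊗ Y, V) → Hom(U, V ⊗ X)`,
`ρ(f) = (f ⊗ X) ∘ assoc⁻¹ ∘ (U ⊗ (φ ∘ η)) ∘ (right unitor)⁻¹`. -/
def frobRho {C : Type u} [Category.{v} C] [MonoidalCategory C]
    (P : LeftFrobeniusPair C) (U V : C) (f : U ⊗ P.Y ⟶ V) : U ⟶ V ⊗ P.X :=
  (ρ_ U).inv ≫ (U ◁ (P.η ≫ P.φ)) ≫ (α_ U P.Y P.X).inv ≫ (f ▷ P.X)


/-- The inverse duality map `ρ⁻¹ : Hom(U, V ⊗ X) → Hom(U ⊗ Y, V)`,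
`ρ⁻¹(g) = right unitor ∘ (V ⊗ (ε ∘ ψ)) ∘ assoc ∘ (g ⊗ Y)`. -/
def frobRhoInv {C : Type u} [Category.{v} C] [MonoidalCategory C]
    (P : LeftFrobeniusPair C) (U V : C) (g : U ⟶ V ⊗ P.X) : U ⊗ P.Y ⟶ V :=
  (g ▷ P.Y) ≫ (α_ V P.X P.Y).hom ≫ (V ◁ (P.ψ ≫ P.ε)) ≫ (ρ_ V).hom


namespace LeftFrobeniusPair

variable {C : Type u} [Category.{v} C] [MonoidalCategory C] (P : LeftFrobeniusPair C)

theorem coevaluation_evaluation :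
    P.X ◁ (P.η ≫ P.φ) ≫ (α_ P.X P.Y P.X).inv ≫ (P.ψ ≫ P.ε) ▷ P.X =
      (ρ_ P.X).hom ≫ (λ_ P.X).inv := by
  calc
    _ = P.X ◁ P.η ≫ (P.X ◁ P.φ ≫ (α_ P.X P.Y P.X).inv ≫ P.ψ ▷ P.X) ≫ P.ε ▷ P.X := by
      simp only [MonoidalCategory.whiskerLeft_comp, comp_whiskerRight, Category.assoc]
    _ = (P.X ◁ P.η ≫ P.μ) ≫ P.φ ≫ P.ε ▷ P.X := by
      rw [← P.phi_module']; simp only [Category.assoc]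
    _ = _ := by rw [P.mul_one', P.coact_counit']

theorem evaluation_coevaluation :
    (P.η ≫ P.φ) ▷ P.Y ≫ (α_ P.Y P.X P.Y).hom ≫ P.Y ◁ (P.ψ ≫ P.ε) =
      (λ_ P.Y).hom ≫ (ρ_ P.Y).inv := by
  calc
    _ = P.η ▷ P.Y ≫ (P.φ ▷ P.Y ≫ (α_ P.Y P.X P.Y).hom ≫ P.Y ◁ P.ψ) ≫ P.Y ◁ P.ε := by
      simp only [MonoidalCategory.whiskerLeft_comp, comp_whiskerRight, Category.assoc]
    _ = (P.η ▷ P.Y ≫ P.ψ) ≫ P.δ ≫ P.Y ◁ P.ε := by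
      rw [← P.psi_comodule']; simp only [Category.assoc]
    _ = _ := by rw [P.one_act', P.comul_counit']

/-- The comonoid `Y` and the monoid `X` of a left Frobenius pair form an exact pairing, with
coevaluation `φ ∘ η` and evaluation `ε ∘ ψ`. -/
abbrev exactPairing_s6 : ExactPairing P.Y P.X where
  coevaluation' := P.η ≫ P.φ
  evaluation' := P.ψ ≫ P.ε
  coevaluation_evaluation' := P.coevaluation_evaluation
  evaluation_coevaluation' := P.evaluation_coevaluation

end LeftFrobeniusPair

/-- `ρ` and `ρ'` are mutually inverse bijections. -/
theorem stmt6 {C : Type u} [Category.{v} C] [MonoidalCategory C]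
    (P : LeftFrobeniusPair C) (U V : C) :
    (∀ f : U ⊗ P.Y ⟶ V, frobRhoInv P U V (frobRho P U V f) = f) ∧
    (∀ g : U ⟶ V ⊗ P.X, frobRho P U V (frobRhoInv P U V g) = g) := by
  let := P.exactPairing_s6
  exact ⟨(tensorRightHomEquiv U P.Y P.X V).left_inv, (tensorRightHomEquiv U P.Y P.X V).right_inv⟩
end

section
/- Let (X, Y, η, μ, ψ, ε, δ, φ) be a left Frobenius pair in a monoidal category C, with α = φ ∘ η and β = ε ∘ ψ. Then λ⁻¹ applied to φ equals μ; that is, the composite X ⊗ X →(X ⊗ φ) X ⊗ (Y ⊗ X) ≅ (X ⊗ Y) ⊗ X →(β ⊗ X) 𝟙 ⊗ X ≅ X equals μ as morphisms X ⊗ X → X. -/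
open CategoryTheory MonoidalCategory

universe v u

/-- `λ⁻¹` applied to `φ` equals `μ`. -/
theorem stmt17 {C : Type u} [Category.{v} C] [MonoidalCategory C]
    (P : LeftFrobeniusPair C) :
    (P.X ◁ P.φ) ≫ (α_ P.X P.Y P.X).inv ≫ ((P.ψ ≫ P.ε) ▷ P.X) ≫ (λ_ P.X).hom = P.μ := by
  rw [comp_whiskerRight, Category.assoc, ← reassoc_of% P.phi_module',
    reassoc_of% P.coact_counit', Iso.inv_hom_id, Category.comp_id]
end

section
/- Let (X, Y, η, μ, ψ, ε, δ, φ) be a left Frobenius pair in a monoidal category C, with α = φ ∘ η and β = ε ∘ ψ. Then ρ⁻¹ applied to φ equals ψ; that is, the composite X ⊗ Y →(φ ⊗ Y) (Y ⊗ X) ⊗ Y ≅ Y ⊗ (X ⊗ Y) →(Y ⊗ β) Y ⊗ 𝟙 ≅ Y equals ψ as morphisms X ⊗ Y → Y. -/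
open CategoryTheory MonoidalCategory

universe v u

/-- `ρ⁻¹` applied to `φ` equals `ψ`. -/
theorem stmt18 {C : Type u} [Category.{v} C] [MonoidalCategory C]
    (P : LeftFrobeniusPair C) :
    (P.φ ▷ P.Y) ≫ (α_ P.Y P.X P.Y).hom ≫ (P.Y ◁ (P.ψ ≫ P.ε)) ≫ (ρ_ P.Y).hom = P.ψ := by
  calc
    _ = ((P.φ ▷ P.Y) ≫ (α_ P.Y P.X P.Y).hom ≫ (P.Y ◁ P.ψ)) ≫ (P.Y ◁ P.ε) ≫ (ρ_ P.Y).hom := by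
      simp only [MonoidalCategory.whiskerLeft_comp, Category.assoc]
    _ = P.ψ ≫ (P.δ ≫ (P.Y ◁ P.ε)) ≫ (ρ_ P.Y).hom := by
      simp only [← P.psi_comodule', Category.assoc]
    _ = P.ψ := by
      rw [P.comul_counit', Iso.inv_hom_id, Category.comp_id]
end
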